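/- The class of passive seeded Tile Automata systems (equivalently, the Abstract Tile Assembly Model) is not intrinsically universal under non-committal simulation: for every rule set I = (Σ, Π, Δ, τ) with Δ empty (passive), there exists a passive seeded Tile Automata system Γ_T such that no system using rule set I non-committally simulates Γ_T. In particular, any passive system using fewer than n states fails to simulate X_n. -/

import Mathlib

open scoped Classical

/-- Positions in the plane. -/
abbrev Pos : Type := ℤ × ℤ

/-- An assembly: a finite partial placement of states (encoded as naturals) on `ℤ²`. -/
structure Assembly where
  tiles : Pos → Option ℕ
  finite : {p : Pos | tiles p ≠ none}.Finite

/-- A transition rule `((σ1, σ2), (σ3, σ4), d)`; `d = true` is horizontal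
(first state west), `d = false` is vertical (first state north). -/
abbrev Rule : Type := (ℕ × ℕ) × (ℕ × ℕ) × Bool

/-- The neighbour of `p` in orientation `d` (east for horizontal, south for vertical). -/
def nbr (p : Pos) (d : Bool) : Pos := if d then (p.1 + 1, p.2) else (p.1, p.2 - 1)

/-- The bond strength contributed by the ordered pair of positions `p`, `q` in `A`. -/
def bond (aff : ℕ → ℕ → Bool → ℕ) (A : Assembly) (p q : Pos) : ℕ :=
  match A.tiles p, A.tiles q with
  | some σ1, some σ2 =>
      (if q = nbr p true then aff σ1 σ2 true else 0) +
      (if q = nbr p false then aff σ1 σ2 false else 0)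
  | _, _ => 0

/-- The total weight of the cut `S` in the bond graph of `A`. -/
noncomputable def cutWeight (aff : ℕ → ℕ → Bool → ℕ) (A : Assembly) (S : Set Pos) : ℕ :=
  ∑ p ∈ A.finite.toFinset, ∑ q ∈ A.finite.toFinset,
    if p ∈ S ∧ q ∉ S then bond aff A p q + bond aff A q p else 0

/-- `A` is `τ`-stable: every cut separating the tiles of `A` has weight at least `τ`. -/
def StableAt (aff : ℕ → ℕ → Bool → ℕ) (τ : ℕ) (A : Assembly) : Prop :=
  ∀ S : Set Pos,
    (∃ p, A.tiles p ≠ none ∧ p ∈ S) → (∃ p, A.tiles p ≠ none ∧ p ∉ S) →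
    τ ≤ cutWeight aff A S

/-- A transition rule is affinity strengthening: it maintains or increases the
affinity of the transitioning pair and of every other potential neighbour. -/
def Strengthening (aff : ℕ → ℕ → Bool → ℕ) (r : Rule) : Prop :=
  aff r.1.1 r.1.2 r.2.2 ≤ aff r.2.1.1 r.2.1.2 r.2.2 ∧
  ∀ (σ : ℕ) (d : Bool),
    aff r.1.1 σ d ≤ aff r.2.1.1 σ d ∧ aff σ r.1.1 d ≤ aff σ r.2.1.1 d ∧
    aff r.1.2 σ d ≤ aff r.2.1.2 σ d ∧ aff σ r.1.2 d ≤ aff σ r.2.1.2 d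

/-- A seeded Tile Automata system `(Σ, Λ, Π, Δ, s, τ)`. -/
structure TASystem where
  states : Finset ℕ
  initial : Finset ℕ
  aff : ℕ → ℕ → Bool → ℕ
  rules : Finset Rule
  seed : Assembly
  temp : ℕ
  temp_pos : 0 < temp
  initial_sub : initial ⊆ states
  seed_states : ∀ p σ, seed.tiles p = some σ → σ ∈ states
  seed_stable : StableAt aff temp seed
  rules_strengthening : ∀ r ∈ rules, Strengthening aff r
  rules_states : ∀ r ∈ rules,
    r.1.1 ∈ states ∧ r.1.2 ∈ states ∧ r.2.1.1 ∈ states ∧ r.2.1.2 ∈ states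

/-- A single-tile attachment step. -/
def AttachStep (Γ : TASystem) (A B : Assembly) : Prop :=
  ∃ (p : Pos) (σ : ℕ), σ ∈ Γ.initial ∧ A.tiles p = none ∧
    B.tiles = Function.update A.tiles p (some σ) ∧
    StableAt Γ.aff Γ.temp B

/-- A pairwise transition step. -/
def TransStep (Γ : TASystem) (A B : Assembly) : Prop :=
  ∃ r ∈ Γ.rules, ∃ p : Pos,
    A.tiles p = some r.1.1 ∧ A.tiles (nbr p r.2.2) = some r.1.2 ∧
    B.tiles = Function.update (Function.update A.tiles p (some r.2.1.1))
      (nbr p r.2.2) (some r.2.1.2)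

/-- A single production step `A →^Γ_1 B`. -/
def Step (Γ : TASystem) (A B : Assembly) : Prop := AttachStep Γ A B ∨ TransStep Γ A B

/-- `A →^Γ B`: reflexive-transitive closure of single steps. -/
def Reach (Γ : TASystem) : Assembly → Assembly → Prop := Relation.ReflTransGen (Step Γ)

/-- The producible assemblies of `Γ`. -/
def Producible (Γ : TASystem) (A : Assembly) : Prop := Reach Γ Γ.seed A

/-- `m`-blocks over (ℕ-encoded) states. -/
abbrev Block (m : ℕ) : Type := Fin m × Fin m → Option ℕ

def emptyBlock (m : ℕ) : Block m := fun _ => none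

/-- A valid `m`-block representation function maps the empty block to empty. -/
def RepFun (m : ℕ) (R : Block m → Option ℕ) : Prop :=
  0 < m ∧ R (emptyBlock m) = none

/-- The `m`-block of `A` with block coordinates `(x, y)`. -/
def blockAt (m : ℕ) (A : Assembly) (x y : ℤ) : Block m :=
  fun ij => A.tiles ((m : ℤ) * x + (ij.1.1 : ℤ), (m : ℤ) * y + (ij.2.1 : ℤ))

/-- `B = R*(A)`: the blockwise image of `A` under `R`. -/
def RepMap (m : ℕ) (R : Block m → Option ℕ) (A B : Assembly) : Prop :=
  ∀ x y : ℤ, B.tiles (x, y) = R (blockAt m A x y)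

/-- Condition 1 of equivalent productions: `{R*(A') : A' ∈ PROD_{Γ_S}} = PROD_{Γ_T}`. -/
def EquivProdSet (m : ℕ) (R : Block m → Option ℕ) (ΓS ΓT : TASystem) : Prop :=
  (∀ A', Producible ΓS A' → ∃ A, Producible ΓT A ∧ RepMap m R A' A) ∧
  (∀ A, Producible ΓT A → ∃ A', Producible ΓS A' ∧ RepMap m R A' A)

/-- `Γ_S` achieves `c`-fuzz under `R*`. -/
def AchievesFuzz (m : ℕ) (R : Block m → Option ℕ) (ΓS : TASystem) (c : ℕ) : Prop :=
  ∀ A', Producible ΓS A' → ∀ x y : ℤ,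
    blockAt m A' x y ≠ emptyBlock m → R (blockAt m A' x y) = none →
    ∃ u v : ℤ, |u| ≤ (c : ℤ) ∧ |v| ≤ (c : ℤ) ∧ R (blockAt m A' (x + u) (y + v)) ≠ none

/-- `Γ_T` follows `Γ_S` under `R`. -/
def Follows (m : ℕ) (R : Block m → Option ℕ) (ΓS ΓT : TASystem) : Prop :=
  ∀ A' B', Producible ΓS A' → Reach ΓS A' B' →
    ∀ A B, RepMap m R A' A → RepMap m R B' B → Reach ΓT A B

/-- `Γ_S` non-committally models `Γ_T` under `R`. -/
def Models (m : ℕ) (R : Block m → Option ℕ) (ΓS ΓT : TASystem) : Prop :=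
  ∀ A B, Producible ΓT A → Reach ΓT A B →
    ∀ A', Producible ΓS A' → RepMap m R A' A →
      ∃ B', Reach ΓS A' B' ∧ RepMap m R B' B

/-- `Γ_S` non-committally simulates `Γ_T` under `R` with fuzz bound `c`. -/
def SimulatesFuzz (m : ℕ) (R : Block m → Option ℕ) (ΓS ΓT : TASystem) (c : ℕ) : Prop :=
  RepFun m R ∧ EquivProdSet m R ΓS ΓT ∧ AchievesFuzz m R ΓS c ∧
  Follows m R ΓS ΓT ∧ Models m R ΓS ΓT

/-- `Γ_S` non-committally simulates `Γ_T` under `R` (with some fuzz bound). -/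
def Simulates (m : ℕ) (R : Block m → Option ℕ) (ΓS ΓT : TASystem) : Prop :=
  ∃ c : ℕ, 0 < c ∧ SimulatesFuzz m R ΓS ΓT c
/-- The assembly consisting of a single tile in state `σ` at `p₀`. -/
def onePoint (p₀ : Pos) (σ : ℕ) : Assembly where
  tiles := fun p => if p = p₀ then some σ else none
  finite := Set.Finite.subset (Set.finite_singleton p₀) (by
    intro p hp
    simp only [Set.mem_setOf_eq] at hp
    by_contra h
    simp only [Set.mem_singleton_iff] at h
    rw [if_neg h] at hp
    exact hp rfl)

/-- The seed assembly of `X_n`: a single tile in state `S` (encoded as `0`) at the origin. -/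
def seedX : Assembly := onePoint ((0 : ℤ), (0 : ℤ)) 0

/-- The assembly `s · a_i`: the seed tile with a tile in state `a_i` (encoded as `i`)
attached to its east. -/
def seedDot (i : ℕ) : Assembly where
  tiles := fun p =>
    if p = ((0 : ℤ), (0 : ℤ)) then some 0
    else if p = ((1 : ℤ), (0 : ℤ)) then some i else none
  finite := Set.Finite.subset
      ((Set.finite_singleton ((0 : ℤ), (0 : ℤ))).insert ((1 : ℤ), (0 : ℤ))) (by
    intro p hp
    simp only [Set.mem_setOf_eq] at hp
    by_contra h
    simp only [Set.mem_insert_iff, Set.mem_singleton_iff] at h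
    push_neg at h
    rw [if_neg h.2, if_neg h.1] at hp
    exact hp rfl)

/-- The passive system `X_n`: states `S = 0` and `a_1, …, a_n`, seed a single `S` tile,
east–west affinity of strength `τ = 1` between `S` and each `a_i`, no transition rules. -/
noncomputable def X (n : ℕ) : TASystem where
  states := Finset.range (n + 1)
  initial := Finset.Icc 1 n
  aff := fun x y d =>
    if d = true ∧ ((x = 0 ∧ 1 ≤ y ∧ y ≤ n) ∨ (y = 0 ∧ 1 ≤ x ∧ x ≤ n)) then 1 else 0
  rules := ∅
  seed := seedX
  temp := 1
  temp_pos := Nat.one_pos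
  initial_sub := by
    intro x hx
    simp only [Finset.mem_Icc] at hx
    simp only [Finset.mem_range]
    omega
  seed_states := by
    intro p σ h
    simp only [seedX, onePoint] at h
    by_cases hp : p = ((0 : ℤ), (0 : ℤ))
    · rw [if_pos hp] at h
      simp only [Option.some.injEq] at h
      simp only [Finset.mem_range]
      omega
    · rw [if_neg hp] at h
      exact absurd h (by simp)
  seed_stable := by
    rintro S ⟨p, hp, hpS⟩ ⟨q, hq, hqS⟩
    exfalso
    have hp' : p = ((0 : ℤ), (0 : ℤ)) := by
      by_contra h
      apply hp
      simp only [seedX, onePoint]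
      rw [if_neg h]
    have hq' : q = ((0 : ℤ), (0 : ℤ)) := by
      by_contra h
      apply hq
      simp only [seedX, onePoint]
      rw [if_neg h]
    rw [hp'] at hpS
    rw [hq'] at hqS
    exact hqS hpS
  rules_strengthening := by intro r hr; simp at hr
  rules_states := by intro r hr; simp at hr

/-- `Γ` is a `k`-burnout system: in any production sequence from the seed,
each tile changes its state at most `k` times. -/
def Burnout (Γ : TASystem) (k : ℕ) : Prop :=
  ∀ (N : ℕ) (seq : Fin (N + 1) → Assembly), seq 0 = Γ.seed →
    (∀ i : Fin N, Step Γ (seq i.castSucc) (seq i.succ)) →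
    ∀ p : Pos,
      (Finset.univ.filter (fun i : Fin N =>
        (seq i.castSucc).tiles p ≠ none ∧
        (seq i.succ).tiles p ≠ (seq i.castSucc).tiles p)).card ≤ k

/-- A bounded system: `k`-burnout for some `k`. -/
def Bounded (Γ : TASystem) : Prop := ∃ k : ℕ, Burnout Γ k

/-- A passive system: `0`-burnout. -/
def Passive (Γ : TASystem) : Prop := Burnout Γ 0

theorem asm_ext {A B : Assembly} (h : A.tiles = B.tiles) : A = B := by
  cases A; cases B; simp only at h; subst h; rfl

def addTile (A : Assembly) (p : Pos) (σ : ℕ) : Assembly where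
  tiles := Function.update A.tiles p (some σ)
  finite := Set.Finite.subset (A.finite.insert p) (by
    intro q hq
    by_cases h : q = p
    · exact Or.inl h
    · right
      simpa [Function.update_of_ne h] using hq)

theorem bond_mono (aff : ℕ → ℕ → Bool → ℕ) {A B : Assembly}
    (h : ∀ p σ, A.tiles p = some σ → B.tiles p = some σ) (p q : Pos) :
    bond aff A p q ≤ bond aff B p q := by
  rcases hp : A.tiles p with _ | a
  · simp [bond, hp]
  rcases hq : A.tiles q with _ | b
  · simp [bond, hp, hq]
  simp [bond, hp, hq, h _ _ hp, h _ _ hq]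

theorem cut_mono (aff : ℕ → ℕ → Bool → ℕ) {A B : Assembly}
    (h : ∀ p σ, A.tiles p = some σ → B.tiles p = some σ) (S : Set Pos) :
    cutWeight aff A S ≤ cutWeight aff B S := by
  have hs : A.finite.toFinset ⊆ B.finite.toFinset := by
    intro p hp
    simp only [Set.Finite.mem_toFinset, Set.mem_setOf_eq] at hp ⊢
    obtain ⟨σ, hσ⟩ := Option.ne_none_iff_exists'.1 hp
    rw [h _ _ hσ]; simp
  unfold cutWeight
  refine le_trans (Finset.sum_le_sum_of_subset hs) (Finset.sum_le_sum fun p _ => ?_)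
  refine le_trans (Finset.sum_le_sum_of_subset hs) (Finset.sum_le_sum fun q _ => ?_)
  split_ifs
  · exact add_le_add (bond_mono aff h p q) (bond_mono aff h q p)
  · exact le_rfl

theorem sub_ne {A B : Assembly}
    (h : ∀ p σ, A.tiles p = some σ → B.tiles p = some σ) {p : Pos}
    (hp : A.tiles p ≠ none) : B.tiles p ≠ none := by
  obtain ⟨σ, hσ⟩ := Option.ne_none_iff_exists'.1 hp
  rw [h _ _ hσ]; simp

/-- Union of two overlapping stable assemblies is stable. -/
theorem stable_union (aff : ℕ → ℕ → Bool → ℕ) (τ : ℕ) {A B E : Assembly}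
    (hA : ∀ p σ, A.tiles p = some σ → E.tiles p = some σ)
    (hB : ∀ p σ, B.tiles p = some σ → E.tiles p = some σ)
    (hE : ∀ p, E.tiles p ≠ none → A.tiles p ≠ none ∨ B.tiles p ≠ none)
    (o : Pos) (oA : A.tiles o ≠ none) (oB : B.tiles o ≠ none)
    (sA : StableAt aff τ A) (sB : StableAt aff τ B) : StableAt aff τ E := by
  rintro S ⟨p, hp, hpS⟩ ⟨q, hq, hqS⟩
  by_cases ho : o ∈ S
  · rcases hE q hq with h | h
    · exact (sA S ⟨o, oA, ho⟩ ⟨q, h, hqS⟩).trans (cut_mono aff hA S)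
    · exact (sB S ⟨o, oB, ho⟩ ⟨q, h, hqS⟩).trans (cut_mono aff hB S)
  · rcases hE p hp with h | h
    · exact (sA S ⟨p, h, hpS⟩ ⟨o, oA, ho⟩).trans (cut_mono aff hA S)
    · exact (sB S ⟨p, h, hpS⟩ ⟨o, oB, ho⟩).trans (cut_mono aff hB S)

theorem attach_sub {Γ : TASystem} {A B : Assembly} (h : AttachStep Γ A B) :
    ∀ p σ, A.tiles p = some σ → B.tiles p = some σ := by
  obtain ⟨q, s, -, hq, hB, -⟩ := h
  intro p σ hp
  have : p ≠ q := by rintro rfl; rw [hq] at hp; cases hp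
  rw [hB, Function.update_of_ne this, hp]

theorem reach_sub {Γ : TASystem} (hr : Γ.rules = ∅) {A B : Assembly} (h : Reach Γ A B) :
    ∀ p σ, A.tiles p = some σ → B.tiles p = some σ := by
  induction h with
  | refl => exact fun _ _ h => h
  | tail _ hs ih =>
    intro p σ hp
    rcases hs with hs | ⟨r, hr', -⟩
    · exact attach_sub hs p σ (ih p σ hp)
    · rw [hr] at hr'; simp at hr'

theorem passive_of_rules {Γ : TASystem} (hr : Γ.rules = ∅) : Passive Γ := by
  intro N seq _ hs p
  rw [Nat.le_zero, Finset.card_eq_zero, Finset.filter_eq_empty_iff]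
  rintro i - ⟨h1, h2⟩
  obtain ⟨σ, hσ⟩ := Option.ne_none_iff_exists'.1 h1
  exact h2 (by rw [hσ, reach_sub hr (Relation.ReflTransGen.single (hs i)) p σ hσ])

theorem reach_seq {Γ : TASystem} {A B : Assembly} (h : Reach Γ A B) :
    ∃ (N : ℕ) (f : ℕ → Assembly), f 0 = A ∧ f N = B ∧ ∀ i < N, Step Γ (f i) (f (i+1)) := by
  induction h with
  | refl => exact ⟨0, fun _ => A, rfl, rfl, by simp⟩
  | @tail b c _ hs ih =>
    obtain ⟨N, f, h0, hN, hf⟩ := ih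
    refine ⟨N+1, Function.update f (N+1) c, ?_, by simp, ?_⟩
    · rw [Function.update_of_ne (by omega), h0]
    · intro i hi
      rw [Function.update_of_ne (by omega)]
      by_cases h : i = N
      · subst h; simpa [hN] using hs
      · rw [Function.update_of_ne (by omega)]; exact hf i (by omega)

theorem passive_trans {Γ : TASystem} (hP : Passive Γ) {A B : Assembly}
    (hA : Producible Γ A) (h : TransStep Γ A B) : B = A := by
  obtain ⟨N, f, h0, hN, hf⟩ := reach_seq hA
  have hne : ∀ p, A.tiles p ≠ none → B.tiles p = A.tiles p := by
    intro p hp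
    by_contra hc
    have := hP (N+1) (fun i => Function.update f (N+1) B i.1)
      (by simp [Function.update_of_ne, h0]) (by
        intro i
        have hi := i.2
        simp only [Fin.val_castSucc, Fin.val_succ]
        rw [Function.update_of_ne (by omega)]
        by_cases h' : i.1 = N
        · rw [h']; simpa [hN, Step] using (Or.inr h : Step Γ A B)
        · rw [Function.update_of_ne (by omega)]; exact hf i (by omega)) p
    rw [Nat.le_zero, Finset.card_eq_zero, Finset.filter_eq_empty_iff] at this
    refine this (Finset.mem_univ (Fin.last N)) ?_
    simp only [Fin.val_castSucc, Fin.val_succ, Fin.val_last]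
    rw [Function.update_of_ne (by omega), hN, Function.update_self]
    exact ⟨hp, hc⟩
  apply asm_ext
  funext p
  by_cases hp : A.tiles p = none
  · obtain ⟨r, -, q, h1, h2, hB⟩ := h
    rw [hB]
    have n1 : p ≠ q := by rintro rfl; rw [hp] at h1; cases h1
    have n2 : p ≠ nbr q r.2.2 := by rintro rfl; rw [hp] at h2; cases h2
    rw [Function.update_of_ne n2, Function.update_of_ne n1]
  · exact hne p hp

theorem reach_head {Γ : TASystem} (hP : Passive Γ) {A B : Assembly}
    (h : Reach Γ A B) : Producible Γ A →
    A = B ∨ ∃ C, AttachStep Γ A C ∧ Reach Γ C B := by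
  induction h using Relation.ReflTransGen.head_induction_on with
  | refl => exact fun _ => Or.inl rfl
  | @head a c hs hr ih =>
    intro hA
    rcases hs with hs | hs
    · exact Or.inr ⟨c, hs, hr⟩
    · have := passive_trans hP hA hs
      subst this
      exact ih hA

theorem X_step (n i : ℕ) (h1 : 1 ≤ i) (hn : i ≤ n) : Reach (X n) seedX (seedDot i) := by
  refine Relation.ReflTransGen.single (Or.inl ⟨(1, 0), i, ?_, ?_, ?_, ?_⟩)
  · simp [X, h1, hn]
  · simp [seedX, onePoint]
  · funext p
    by_cases hp : p = ((1 : ℤ), (0 : ℤ))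
    · subst hp; simp [seedDot]
    · simp [seedDot, seedX, onePoint, Function.update_of_ne hp, hp]
  · have t0 : (seedDot i).tiles (0, 0) = some 0 := by simp [seedDot]
    have t1 : (seedDot i).tiles (1, 0) = some i := by simp [seedDot]
    have hb : 1 ≤ bond (X n).aff (seedDot i) (0, 0) (1, 0) := by
      unfold bond
      rw [t0, t1]
      simp [nbr, X, h1, hn]
    have key : ∀ p, (seedDot i).tiles p ≠ none → p = (0, 0) ∨ p = (1, 0) := by
      intro p hp
      by_contra hc
      push Not at hc
      exact hp (by simp [seedDot, hc.1, hc.2])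
    have m0 : ((0, 0) : Pos) ∈ (seedDot i).finite.toFinset := by simp [t0]
    have m1 : ((1, 0) : Pos) ∈ (seedDot i).finite.toFinset := by simp [t1]
    have gen : ∀ (S : Set Pos) (p q : Pos), p ∈ (seedDot i).finite.toFinset →
        q ∈ (seedDot i).finite.toFinset → p ∈ S → q ∉ S →
        bond (X n).aff (seedDot i) p q + bond (X n).aff (seedDot i) q p
          ≤ cutWeight (X n).aff (seedDot i) S := by
      intro S p q hp hq hpS hqS
      unfold cutWeight
      refine le_trans ?_ (Finset.single_le_sum (fun _ _ => Nat.zero_le _) hp)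
      refine le_trans ?_ (Finset.single_le_sum (fun _ _ => Nat.zero_le _) hq)
      rw [if_pos ⟨hpS, hqS⟩]
    rintro S ⟨p, hp, hpS⟩ ⟨q, hq, hqS⟩
    change 1 ≤ _
    rcases key p hp with rfl | rfl <;> rcases key q hq with rfl | rfl
    · exact absurd hpS hqS
    · have := gen S _ _ m0 m1 hpS hqS; omega
    · have := gen S _ _ m1 m0 hpS hqS; omega
    · exact absurd hpS hqS

theorem X_mid (n i : ℕ) {D : Assembly} (h1 : Reach (X n) seedX D)
    (h2 : Reach (X n) D (seedDot i)) (hne : D ≠ seedX) : D.tiles (1, 0) = some i := by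
  have s1 := reach_sub rfl h1
  have s2 := reach_sub rfl h2
  have d0 : D.tiles (0, 0) = some 0 := s1 _ _ (by simp [seedX, onePoint])
  rcases h : D.tiles (1, 0) with _ | j
  · exfalso
    apply hne
    apply asm_ext
    funext p
    by_cases hp : p = ((0 : ℤ), (0 : ℤ))
    · subst hp; rw [d0]; simp [seedX, onePoint]
    · rcases hD : D.tiles p with _ | σ
      · simp [seedX, onePoint, hp]
      · have := s2 _ _ hD
        by_cases hp1 : p = ((1 : ℤ), (0 : ℤ))
        · subst hp1; rw [h] at hD; cases hD
        · simp [seedDot, hp, hp1] at this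
  · have := s2 _ _ h
    simp [seedDot] at this
    rw [this]

theorem card_add {Γ : TASystem} {A C : Assembly} (h : AttachStep Γ A C) :
    A.finite.toFinset.card < C.finite.toFinset.card := by
  apply Finset.card_lt_card
  have hs := attach_sub h
  obtain ⟨p, σ, -, hp, hC, -⟩ := h
  rw [Finset.ssubset_iff_of_subset]
  · exact ⟨p, by simp [hC], by simp [hp]⟩
  · intro q hq
    simp only [Set.Finite.mem_toFinset, Set.mem_setOf_eq] at hq ⊢
    exact sub_ne hs hq

theorem main_X (n : ℕ) (Y : TASystem) (hP : Passive Y) (hc : Y.states.card < n)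
    (m : ℕ) (R : Block m → Option ℕ) : ¬ Simulates m R Y (X n) := by
  rintro ⟨c, -, ⟨hm, hR⟩, ⟨hE1, hE2⟩, hF, hFol, hMod⟩
  have hm' : (0 : ℤ) < m := by exact_mod_cast hm
  -- maximal preimage of the seed
  let K : Set ℕ := {k | ∃ A', Producible Y A' ∧ RepMap m R A' seedX ∧
    A'.finite.toFinset.card = k}
  have hKne : K.Nonempty := by
    obtain ⟨A', h1, h2⟩ := hE2 seedX Relation.ReflTransGen.refl
    exact ⟨_, A', h1, h2, rfl⟩
  have hKb : BddAbove K := by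
    refine ⟨((Finset.Icc (-(m * c : ℤ)) (m * c + m)) ×ˢ
      (Finset.Icc (-(m * c : ℤ)) (m * c + m))).card, ?_⟩
    rintro k ⟨A', h1, h2, rfl⟩
    apply Finset.card_le_card
    rintro ⟨a, b⟩ hp
    simp only [Set.Finite.mem_toFinset, Set.mem_setOf_eq] at hp
    have ha := Int.emod_add_mul_ediv a m
    have hb := Int.emod_add_mul_ediv b m
    have ha0 := Int.emod_nonneg a hm'.ne'
    have hb0 := Int.emod_nonneg b hm'.ne'
    have ha1 := Int.emod_lt_of_pos a hm'
    have hb1 := Int.emod_lt_of_pos b hm'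
    have hz : ∀ x y : ℤ, R (blockAt m A' x y) ≠ none → x = 0 ∧ y = 0 := by
      intro x y h
      rw [← h2 x y] at h
      by_contra hcon
      apply h
      simp only [seedX, onePoint]
      rw [if_neg]
      simpa [Prod.ext_iff] using hcon
    have hblk : blockAt m A' (a / m) (b / m) ≠ emptyBlock m := by
      intro h
      have := congrFun h (⟨(a % m).toNat, by omega⟩, ⟨(b % m).toNat, by omega⟩)
      simp only [blockAt, emptyBlock, Int.toNat_of_nonneg ha0, Int.toNat_of_nonneg hb0] at this
      apply hp
      rw [← this]
      congr 2 <;> omega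
    have hxy : |a / (m:ℤ)| ≤ c ∧ |b / (m:ℤ)| ≤ c := by
      by_cases h : R (blockAt m A' (a / m) (b / m)) = none
      · obtain ⟨u, v, hu, hv, huv⟩ := hF A' h1 _ _ hblk h
        obtain ⟨e1, e2⟩ := hz _ _ huv
        rw [abs_le] at *
        rw [abs_le] at *
        omega
      · obtain ⟨e1, e2⟩ := hz _ _ h
        rw [e1, e2]; simp
    obtain ⟨hx, hy⟩ := hxy
    rw [abs_le] at hx hy
    simp only [Finset.mem_product, Finset.mem_Icc]
    refine ⟨⟨?_, ?_⟩, ⟨?_, ?_⟩⟩ <;> nlinarith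
  obtain ⟨A', hA, hAr, hAc⟩ := Nat.sSup_mem hKne hKb
  have hmax : ∀ C, Producible Y C → RepMap m R C seedX →
      C.finite.toFinset.card ≤ A'.finite.toFinset.card := by
    intro C h1 h2
    rw [hAc]
    exact le_csSup hKb ⟨C, h1, h2, rfl⟩
  have hA0 : ∃ o, A'.tiles o ≠ none := by
    by_contra hcon
    push Not at hcon
    have h0 := hAr 0 0
    have : blockAt m A' 0 0 = emptyBlock m := by
      funext ij; exact hcon _
    rw [this, hR] at h0
    simp [seedX, onePoint] at h0
  obtain ⟨o, ho⟩ := hA0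
  have key : ∀ i, i ∈ Finset.Icc 1 n → ∃ (p : Pos) (σ : ℕ), σ ∈ Y.initial ∧
      A'.tiles p = none ∧ StableAt Y.aff Y.temp (addTile A' p σ) ∧
      ∃ D, Producible (X n) D ∧ RepMap m R (addTile A' p σ) D ∧ D.tiles (1, 0) = some i := by
    intro i hi
    rw [Finset.mem_Icc] at hi
    have hX := X_step n i hi.1 hi.2
    obtain ⟨B', hB, hBr⟩ := hMod _ _ Relation.ReflTransGen.refl hX A' hA hAr
    rcases reach_head hP hB hA with rfl | ⟨C, hs, hCB⟩
    · exfalso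
      have e1 := hAr 1 0
      have e2 := hBr 1 0
      rw [← e1] at e2
      simp [seedX, seedDot, onePoint] at e2
    · have hAC : Reach Y A' C := Relation.ReflTransGen.single (Or.inl hs)
      have hC : Producible Y C := Relation.ReflTransGen.trans hA hAC
      obtain ⟨D, hD, hCD⟩ := hE1 C hC
      have hDne : D ≠ seedX := by
        rintro rfl
        have := hmax C hC hCD
        have := card_add hs
        omega
      have hDi := X_mid n i (hFol _ _ hA hAC _ _ hAr hCD) (hFol _ _ hC hCB _ _ hCD hBr) hDne
      obtain ⟨p, σ, h1, h2, h3, h4⟩ := hs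
      have : C = addTile A' p σ := asm_ext h3
      subst this
      exact ⟨p, σ, h1, h2, h4, D, hD, hCD, hDi⟩
  choose! P T hT hPn hSt D hD hRD hDi using key
  have hinj : Set.InjOn T (Finset.Icc 1 n : Finset ℕ) := by
    intro i hi j hj hij
    rw [Finset.mem_coe] at hi hj
    by_cases hp : P i = P j
    · have e1 := hRD i hi 1 0
      have e2 := hRD j hj 1 0
      rw [hij, hp, ← e2, hDi i hi, hDi j hj] at e1
      simpa using e1
    · let E := addTile (addTile A' (P i) (T i)) (P j) (T j)
      have hEj : E.tiles = Function.update (addTile A' (P j) (T j)).tiles (P i) (some (T i)) := by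
        exact Function.update_comm hp (some (T i)) (some (T j)) A'.tiles
      have n1 : (addTile A' (P i) (T i)).tiles (P j) = none := by
        simp only [addTile]; rw [Function.update_of_ne (Ne.symm hp)]; exact hPn j hj
      have n2 : (addTile A' (P j) (T j)).tiles (P i) = none := by
        simp only [addTile]; rw [Function.update_of_ne hp]; exact hPn i hi
      have hES : StableAt Y.aff Y.temp E := by
        refine stable_union Y.aff Y.temp (A := addTile A' (P i) (T i))
          (B := addTile A' (P j) (T j)) ?_ ?_ ?_ o ?_ ?_ (hSt i hi) (hSt j hj)
        · intro q σ hq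
          have : q ≠ P j := by rintro rfl; rw [n1] at hq; cases hq
          change Function.update _ _ _ _ = _
          rw [Function.update_of_ne this, hq]
        · intro q σ hq
          have : q ≠ P i := by rintro rfl; rw [n2] at hq; cases hq
          rw [hEj, Function.update_of_ne this, hq]
        · intro q hq
          by_cases h : q = P j
          · right; subst h; simp [addTile]
          · left
            change Function.update _ _ _ _ ≠ _ at hq
            rwa [Function.update_of_ne h] at hq
        · have : o ≠ P i := by rintro rfl; exact ho (hPn i hi)
          simpa [addTile, Function.update_of_ne this] using ho
        · have : o ≠ P j := by rintro rfl; exact ho (hPn j hj)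
          simpa [addTile, Function.update_of_ne this] using ho
      have pr : ∀ k ∈ Finset.Icc 1 n, Producible Y (addTile A' (P k) (T k)) := fun k hk =>
        Relation.ReflTransGen.tail hA (Or.inl ⟨P k, T k, hT k hk, hPn k hk, rfl, hSt k hk⟩)
      have ri : Reach Y (addTile A' (P i) (T i)) E :=
        Relation.ReflTransGen.single (Or.inl ⟨P j, T j, hT j hj, n1, rfl, hES⟩)
      have rj : Reach Y (addTile A' (P j) (T j)) E :=
        Relation.ReflTransGen.single (Or.inl ⟨P i, T i, hT i hi, n2, hEj, hES⟩)
      obtain ⟨F, -, hEF⟩ := hE1 E (Relation.ReflTransGen.trans (pr i hi) ri)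
      have f1 := reach_sub rfl (hFol _ _ (pr i hi) ri _ _ (hRD i hi) hEF) _ _ (hDi i hi)
      have f2 := reach_sub rfl (hFol _ _ (pr j hj) rj _ _ (hRD j hj) hEF) _ _ (hDi j hj)
      rw [f1] at f2
      simpa using f2
  have := Finset.card_le_card_of_injOn T (fun i hi => Y.initial_sub (hT i hi)) hinj
  rw [Nat.card_Icc] at this
  omega

/-- The class of passive seeded Tile Automata systems (equivalently,
the aTAM) is not intrinsically universal under non-committal simulation: for every
passive rule set `I = (Σ, Π, ∅, τ)` there is a passive system `Γ_T` that no system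
using `I` non-committally simulates; in particular, any passive system with fewer
than `n` states fails to simulate `X_n`. -/
theorem atamNotIU :
    (∀ (St : Finset ℕ) (aff : ℕ → ℕ → Bool → ℕ) (τ : ℕ),
      ∃ ΓT : TASystem, Passive ΓT ∧
        ∀ ΓS : TASystem,
          ΓS.states = St → ΓS.aff = aff → ΓS.rules = ∅ → ΓS.temp = τ →
          ∀ (m : ℕ) (R : Block m → Option ℕ), ¬ Simulates m R ΓS ΓT) ∧
    (∀ (n : ℕ) (Y : TASystem), Passive Y → Y.states.card < n →
      ∀ (m : ℕ) (R : Block m → Option ℕ), ¬ Simulates m R Y (X n)) := by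
  refine ⟨fun St aff τ => ⟨X (St.card + 1), passive_of_rules rfl, ?_⟩, main_X⟩
  intro Y hSt _ hr _ m R
  exact main_X _ Y (passive_of_rules hr) (by rw [hSt]; omega) m R
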